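/- arXiv:1906.06261 — 2 statements merged into one kernel-verified Lean document; each statement's English description precedes it below -/
import Mathlib

section
/- Let (X,d) be a complete cone metric space over a Banach algebra A with solid cone P, and let T_n, T : X → X (n ∈ ℕ) satisfy: (i) each T_n has at least one fixed point x_n; (ii) T is an α-contraction w.r.t. d for some α ∈ P with ρ(α) < 1; (iii) T_n converges uniformly to T w.r.t. d. Then T has a unique fixed point x*, and the sequence (d(x_n, x*))_{n∈ℕ} is a c-sequence. -/
open Filter Topology

/-- Spectral radius via the Gelfand formula: `inf_{n ≥ 1} ‖k ^ n‖ ^ (1 / n)`. -/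
noncomputable def specRad {A : Type*} [NormedRing A] (k : A) : ℝ :=
  ⨅ n : ℕ, ‖k ^ (n + 1)‖ ^ ((1 : ℝ) / (n + 1))

/-- A cone in a real Banach algebra `A`: a nonempty closed subset containing `0` and `1`,
closed under nonnegative real combinations and multiplication, with `P ∩ (-P) = {0}`. -/
structure IsCone {A : Type*} [NormedRing A] [NormedAlgebra ℝ A] (P : Set A) : Prop where
  closed : IsClosed P
  zero_mem : (0 : A) ∈ P
  one_mem : (1 : A) ∈ P
  smul_mem : ∀ a : ℝ, 0 ≤ a → ∀ x ∈ P, a • x ∈ P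
  add_mem : ∀ x ∈ P, ∀ y ∈ P, x + y ∈ P
  mul_mem : ∀ x ∈ P, ∀ y ∈ P, x * y ∈ P
  antisymm : ∀ x ∈ P, -x ∈ P → x = 0

/-- A c-sequence with respect to the solid cone `P`: for every `c ≫ 0` eventually `u n ≪ c`. -/
def CSeq {A : Type*} [NormedRing A] [NormedAlgebra ℝ A] (P : Set A) (u : ℕ → A) : Prop :=
  ∀ c : A, c ∈ interior P → ∃ N : ℕ, ∀ n ≥ N, c - u n ∈ interior P

/-- A cone metric on `X` over the Banach algebra `A` with cone `P`. -/
structure IsConeMetric {A : Type*} [NormedRing A] [NormedAlgebra ℝ A] (P : Set A)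
    {X : Type*} (d : X → X → A) : Prop where
  mem_cone : ∀ x y, d x y ∈ P
  eq_zero_iff : ∀ x y, d x y = 0 ↔ x = y
  symm : ∀ x y, d x y = d y x
  triangle : ∀ x y z, d x y + d y z - d x z ∈ P

/-- Completeness of a cone metric space over a Banach algebra:
every Cauchy sequence converges (in the c-sequence sense). -/
def ConeComplete {A : Type*} [NormedRing A] [NormedAlgebra ℝ A] (P : Set A)
    {X : Type*} (d : X → X → A) : Prop :=
  ∀ u : ℕ → X,
    (∀ c : A, c ∈ interior P → ∃ N : ℕ, ∀ m ≥ N, ∀ n ≥ N, c - d (u m) (u n) ∈ interior P) →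
    ∃ x : X, CSeq P fun n => d (u n) x

/-- `Tinf` is a (G)-limit of the family `T` (property (G)). -/
def GLimit {A : Type*} [NormedRing A] [NormedAlgebra ℝ A] (P : Set A)
    {X : Type*} (d : X → X → A) (Xn : ℕ → Set X) (Xinf : Set X)
    (T : ℕ → X → X) (Tinf : X → X) : Prop :=
  ∀ x ∈ Xinf, ∃ u : ℕ → X, (∀ n, u n ∈ Xn n) ∧
    CSeq P (fun n => d (u n) x) ∧ CSeq P (fun n => d (T n (u n)) (Tinf x))

/-- `Tinf` is an (H)-limit of the family `T` (property (H)). -/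
def HLimit {A : Type*} [NormedRing A] [NormedAlgebra ℝ A] (P : Set A)
    {X : Type*} (d : X → X → A) (Xn : ℕ → Set X) (Xinf : Set X)
    (T : ℕ → X → X) (Tinf : X → X) : Prop :=
  ∀ u : ℕ → X, (∀ n, u n ∈ Xn n) → ∃ v : ℕ → X, (∀ n, v n ∈ Xinf) ∧
    CSeq P (fun n => d (u n) (v n)) ∧ CSeq P (fun n => d (T n (u n)) (Tinf (v n)))

theorem exists_norm_pow_lt_one_of_specRad_lt_one {A : Type*} [NormedRing A] {a : A}
    (h : specRad a < 1) :
    ∃ m : ℕ, ‖a ^ m‖ < 1 := by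
  obtain ⟨n, hn⟩ := exists_lt_of_ciInf_lt h
  refine ⟨n + 1, lt_of_not_ge fun hge => hn.not_ge ?_⟩
  exact Real.one_le_rpow hge (by positivity)

section ConeLemmas

variable {A : Type*} [NormedRing A] [NormedAlgebra ℝ A] {P : Set A}

theorem IsCone.interior_add_mem (hP : IsCone P) {c p : A} (hc : c ∈ interior P) (hp : p ∈ P) :
    c + p ∈ interior P := by
  have hsub : (fun x => x + p) '' interior P ⊆ P := by
    rintro _ ⟨y, hy, rfl⟩
    exact hP.add_mem _ (interior_subset hy) _ hp
  exact interior_maximal hsub ((Homeomorph.addRight p).isOpenMap _ isOpen_interior) ⟨c, hc, rfl⟩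

theorem IsCone.interior_smul_mem (hP : IsCone P) {t : ℝ} (ht : 0 < t) {c : A}
    (hc : c ∈ interior P) : t • c ∈ interior P := by
  have hsub : (fun x => t • x) '' interior P ⊆ P := by
    rintro _ ⟨y, hy, rfl⟩
    exact hP.smul_mem t ht.le _ (interior_subset hy)
  exact interior_maximal hsub ((isOpenMap_smul₀ ht.ne') _ isOpen_interior) ⟨c, hc, rfl⟩

theorem IsCone.sum_mem (hP : IsCone P) {ι : Type*} (s : Finset ι) {f : ι → A}
    (hf : ∀ i, f i ∈ P) : ∑ i ∈ s, f i ∈ P :=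
  Finset.sum_induction f (· ∈ P) (fun a b ha hb => hP.add_mem a ha b hb) hP.zero_mem
    fun i _ => hf i

theorem IsCone.pow_mem (hP : IsCone P) {a : A} (ha : a ∈ P) (n : ℕ) : a ^ n ∈ P := by
  induction n with
  | zero => simpa using hP.one_mem
  | succ n ih => simpa [pow_succ] using hP.mul_mem _ ih _ ha

theorem CSeq.of_sub_mem (hP : IsCone P) {u v : ℕ → A} (hv : CSeq P v)
    (h : ∀ n, v n - u n ∈ P) : CSeq P u := by
  intro c hc
  obtain ⟨N, hN⟩ := hv c hc
  refine ⟨N, fun n hn => ?_⟩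
  simpa using hP.interior_add_mem (hN n hn) (h n)

theorem CSeq.add (hP : IsCone P) {u v : ℕ → A} (hu : CSeq P u) (hv : CSeq P v) :
    CSeq P fun n => u n + v n := by
  intro c hc
  have hc2 := hP.interior_smul_mem (t := 1 / 2) (by norm_num) hc
  obtain ⟨N, hN⟩ := hu _ hc2
  obtain ⟨M, hM⟩ := hv _ hc2
  refine ⟨max N M, fun n hn => ?_⟩
  have h := hP.interior_add_mem (hN n (le_of_max_le_left hn))
    (interior_subset (hM n (le_of_max_le_right hn)))
  convert h using 1
  module

theorem CSeq.of_tendsto_zero {u : ℕ → A} (hu : Tendsto u atTop (𝓝 0)) : CSeq P u := by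
  intro c hc
  have h : Tendsto (fun n => c - u n) atTop (𝓝 c) := by
    simpa using tendsto_const_nhds.sub hu
  exact eventually_atTop.mp (h (isOpen_interior.mem_nhds hc))

theorem tendsto_inv_add_one_smul (c : A) :
    Tendsto (fun n : ℕ => (1 / ((n : ℝ) + 1)) • c) atTop (𝓝 0) := by
  simpa using (tendsto_one_div_add_atTop_nhds_zero_nat (𝕜 := ℝ)).smul_const c

theorem CSeq.mul_left (hP : IsCone P) {a : A} (ha : a ∈ P) {u : ℕ → A} (hu : CSeq P u) :
    CSeq P fun n => a * u n := by
  intro c hc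
  have hlim : Tendsto (fun n : ℕ => a * ((1 / ((n : ℝ) + 1)) • c)) atTop (𝓝 0) := by
    simpa using (tendsto_inv_add_one_smul c).const_mul a
  obtain ⟨k, hk⟩ := CSeq.of_tendsto_zero (P := P) hlim c hc
  obtain ⟨N, hN⟩ := hu _ (hP.interior_smul_mem (t := 1 / ((k : ℝ) + 1)) (by positivity) hc)
  refine ⟨N, fun n hn => ?_⟩
  have h := hP.interior_add_mem (hk k le_rfl) (hP.mul_mem _ ha _ (interior_subset (hN n hn)))
  convert h using 1
  rw [mul_sub]
  abel

theorem IsCone.eq_zero_of_cSeq_const (hP : IsCone P) (hsolid : (interior P).Nonempty) {a : A}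
    (ha : a ∈ P) (h : CSeq P fun _ => a) : a = 0 := by
  obtain ⟨c, hc⟩ := hsolid
  refine hP.antisymm a ha (hP.closed.mem_of_tendsto (b := atTop)
    (f := fun n : ℕ => (1 / ((n : ℝ) + 1)) • c - a) ?_ (Eventually.of_forall fun n => ?_))
  · simpa using (tendsto_inv_add_one_smul c).sub_const a
  · obtain ⟨N, hN⟩ := h _ (hP.interior_smul_mem (t := 1 / ((n : ℝ) + 1)) (by positivity) hc)
    exact interior_subset (hN N le_rfl)

/-- The inverse of `1 - a` given by the Neumann series lies in the cone. -/
theorem IsCone.exists_mul_one_sub_eq_one [CompleteSpace A] (hP : IsCone P) {a : A} (ha : a ∈ P)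
    {m : ℕ} (hm : ‖a ^ m‖ < 1) : ∃ s ∈ P, s * (1 - a) = 1 := by
  have hsum : Summable fun n : ℕ => (a ^ m) ^ n := summable_geometric_of_norm_lt_one hm
  refine ⟨(∑' n : ℕ, (a ^ m) ^ n) * ∑ i ∈ Finset.range m, a ^ i,
    hP.mul_mem _ ?_ _ (hP.sum_mem _ fun i => hP.pow_mem ha i), ?_⟩
  · exact hP.closed.mem_of_tendsto hsum.hasSum
      (Eventually.of_forall fun t => hP.sum_mem t fun i => hP.pow_mem (hP.pow_mem ha m) i)
  · rw [mul_assoc, geom_sum_mul_neg]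
    exact geom_series_mul_neg _ hm

variable {X : Type*} {d : X → X → A} {S : X → X} {α : A}

/-- For an `α`-contraction, distances are controlled by displacements. -/
theorem IsConeMetric.sub_mem_of_contraction (hP : IsCone P) (hd : IsConeMetric P d)
    (hS : ∀ a b, α * d a b - d (S a) (S b) ∈ P) {s : A} (hs : s ∈ P) (hsα : s * (1 - α) = 1)
    (a b : X) : s * (d a (S a) + d b (S b)) - d a b ∈ P := by
  have h := hP.mul_mem _ hs _ (hP.add_mem _ (hP.add_mem _ (hd.triangle a (S a) b) _
    (hd.triangle (S a) (S b) b)) _ (hS a b))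
  convert h using 1
  have h1 : d a b = s * ((1 - α) * d a b) := by rw [← mul_assoc, hsα, one_mul]
  rw [hd.symm (S b) b]
  nth_rewrite 1 [h1]
  rw [← mul_sub]
  congr 1
  noncomm_ring

theorem IsCone.iterate_contraction (hP : IsCone P) (hα : α ∈ P)
    (hS : ∀ a b, α * d a b - d (S a) (S b) ∈ P) (n : ℕ) (a b : X) :
    α ^ n * d a b - d (S^[n] a) (S^[n] b) ∈ P := by
  induction n with
  | zero => simpa using hP.zero_mem
  | succ n ih =>
    rw [Function.iterate_succ_apply', Function.iterate_succ_apply']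
    have h := hP.add_mem _ (hP.mul_mem _ hα _ ih) _ (hS (S^[n] a) (S^[n] b))
    convert h using 1
    rw [pow_succ']
    noncomm_ring

end ConeLemmas

/-- Uniform convergence of `T n` to an `α`-contraction `T∞` on a complete cone metric space
over a Banach algebra: the fixed points `x n` of `T n` converge to the unique fixed point of
`T∞` in the c-sequence sense. -/
theorem fixedPoints_cSeq_of_uniform_convergence {A : Type*} [NormedRing A] [NormedAlgebra ℝ A]
    [CompleteSpace A] {X : Type*} [Nonempty X]
    (P : Set A) (hP : IsCone P) (hsolid : (interior P).Nonempty)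
    (d : X → X → A) (hd : IsConeMetric P d) (hcompl : ConeComplete P d)
    (T : ℕ → X → X) (Tinf : X → X)
    (x : ℕ → X) (hfix : ∀ n, T n (x n) = x n)
    (α : A) (hα : α ∈ P) (hρ : specRad α < 1)
    (hcontr : ∀ a b : X, α * d a b - d (Tinf a) (Tinf b) ∈ P)
    (hunif : ∀ c : A, c ∈ interior P → ∃ N : ℕ, ∀ n ≥ N, ∀ a : X,
      c - d (T n a) (Tinf a) ∈ interior P) :
    ∃ xs : X, Tinf xs = xs ∧ (∀ y : X, Tinf y = y → y = xs) ∧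
      CSeq P fun n => d (x n) xs := by
  obtain ⟨m, hm⟩ := exists_norm_pow_lt_one_of_specRad_lt_one hρ
  obtain ⟨s, hs, hsα⟩ := hP.exists_mul_one_sub_eq_one hα hm
  have hctrl := hd.sub_mem_of_contraction hP hcontr hs hsα
  have hself : ∀ a, d a a = 0 := fun a => (hd.eq_zero_iff a a).mpr rfl
  let x₀ : X := Classical.arbitrary X
  let u : ℕ → X := fun n => Tinf^[m * n] x₀
  have hdisp : CSeq P fun n => d (u n) (Tinf (u n)) := by
    refine CSeq.of_sub_mem hP (v := fun n => (α ^ m) ^ n * d x₀ (Tinf x₀))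
      (CSeq.of_tendsto_zero ?_) fun n => ?_
    · simpa using (tendsto_pow_atTop_nhds_zero_of_norm_lt_one hm).mul_const (d x₀ (Tinf x₀))
    · have h := hP.iterate_contraction hα hcontr (m * n) x₀ (Tinf x₀)
      rwa [← Function.iterate_succ_apply, Function.iterate_succ_apply', pow_mul] at h
  obtain ⟨xs, hxs⟩ := hcompl u fun c hc => by
    obtain ⟨N, hN⟩ := hdisp.mul_left hP hs _
      (hP.interior_smul_mem (t := 1 / 2) (by norm_num) hc)
    refine ⟨N, fun i hi j hj => ?_⟩
    have h := hP.interior_add_mem (hP.interior_add_mem (hN i hi) (interior_subset (hN j hj)))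
      (hctrl (u i) (u j))
    convert h using 1
    rw [mul_add]
    module
  have hfixed : Tinf xs = xs := by
    refine (hd.eq_zero_iff _ _).mp (hP.eq_zero_of_cSeq_const hsolid (hd.mem_cone _ _) ?_)
    refine CSeq.of_sub_mem hP (((hxs.mul_left hP hα).add hP hdisp).add hP hxs) fun n => ?_
    have h := hP.add_mem _ (hP.add_mem _ (hd.triangle (Tinf xs) (Tinf (u n)) xs) _
      (hd.triangle (Tinf (u n)) (u n) xs)) _ (hcontr (u n) xs)
    convert h using 1
    rw [hd.symm (Tinf xs) (Tinf (u n)), hd.symm (Tinf (u n)) (u n)]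
    abel
  refine ⟨xs, hfixed, fun y hy => ?_, ?_⟩
  · have h := hctrl y xs
    rw [hy, hfixed, hself, hself, add_zero, mul_zero, zero_sub] at h
    exact (hd.eq_zero_iff _ _).mp (hP.antisymm _ (hd.mem_cone _ _) h)
  · have hunif' : CSeq P fun n => d (x n) (Tinf (x n)) := fun c hc => by
      obtain ⟨N, hN⟩ := hunif c hc
      exact ⟨N, fun n hn => by simpa only [hfix] using hN n hn (x n)⟩
    refine CSeq.of_sub_mem hP (hunif'.mul_left hP hs) fun n => ?_
    simpa only [hfixed, hself, add_zero] using hctrl (x n) xs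
end

section
/- Let (X,d) be a cone metric space over a Banach algebra A with solid cone P, let M be a nonempty subset of X, and let T_n : M → X be maps such that the family (T_n) has property (G) with (G)-limit T_∞ : M → X. Assume: (i) the family (T_n) is equicontinuous on M, i.e. for every c₁ with θ ≪ c₁ and every x ∈ M there exists c₂ with θ ≪ c₂ such that for all y ∈ M with d(x,y) ≪ c₂ one has d(T_n x, T_n y) ≪ c₁ for every n; (ii) each T_n has a fixed point x_n and T_∞ has a fixed point x_∞. Then T_n converges pointwise to T_∞ on M w.r.t. d. -/
open Filter Topology

/-- The interior of a cone is stable under adding elements of the cone. -/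
theorem IsCone.add_mem_interior {A : Type*} [NormedRing A] [NormedAlgebra ℝ A] {P : Set A}
    (hP : IsCone P) {x y : A} (hx : x ∈ interior P) (hy : y ∈ P) : x + y ∈ interior P := by
  have hopen : IsOpen ((fun z => z - y) ⁻¹' interior P) :=
    isOpen_interior.preimage (by fun_prop)
  refine interior_maximal (fun z hz => ?_) hopen (show x + y - y ∈ interior P by simpa using hx)
  simpa using hP.add_mem _ (interior_subset hz) _ hy

/-- The interior of a cone is stable under scaling by positive reals. -/
theorem IsCone.smul_mem_interior {A : Type*} [NormedRing A] [NormedAlgebra ℝ A] {P : Set A}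
    (hP : IsCone P) {t : ℝ} (ht : 0 < t) {x : A} (hx : x ∈ interior P) :
    t • x ∈ interior P := by
  have hopen : IsOpen ((fun z : A => t⁻¹ • z) ⁻¹' interior P) :=
    isOpen_interior.preimage (by fun_prop)
  refine interior_maximal (fun z hz => ?_) hopen
    (show t⁻¹ • t • x ∈ interior P by rwa [inv_smul_smul₀ ht.ne'])
  simpa [smul_inv_smul₀ ht.ne'] using hP.smul_mem t ht.le _ (interior_subset hz)

/-- If the family `(T n)` has property (G) on `M` with (G)-limit `T∞`, is equicontinuous on
`M`, each `T n` has a fixed point in `M` and `T∞` has a fixed point in `M`, then `T n`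
converges pointwise to `T∞` on `M` with respect to the cone metric. -/
theorem pointwise_convergence_of_gLimit_equicontinuous {A : Type*} [NormedRing A]
    [NormedAlgebra ℝ A] [CompleteSpace A] {X : Type*}
    (P : Set A) (hP : IsCone P) (hsolid : (interior P).Nonempty)
    (d : X → X → A) (hd : IsConeMetric P d)
    (M : Set X) (hM : M.Nonempty) (T : ℕ → X → X) (Tinf : X → X)
    (hG : GLimit P d (fun _ => M) M T Tinf)
    (hequi : ∀ c₁ ∈ interior P, ∀ x ∈ M, ∃ c₂ ∈ interior P, ∀ y ∈ M,
      c₂ - d x y ∈ interior P → ∀ n, c₁ - d (T n x) (T n y) ∈ interior P)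
    (x : ℕ → X) (hx : ∀ n, x n ∈ M) (hfix : ∀ n, T n (x n) = x n)
    (xinf : X) (hxinf : xinf ∈ M) (hfixinf : Tinf xinf = xinf) :
    ∀ a ∈ M, CSeq P fun n => d (T n a) (Tinf a) := by
  intro a ha c hc
  obtain ⟨u, hu, hua, hTu⟩ := hG a ha
  have hhalf : (1 / 2 : ℝ) • c ∈ interior P := hP.smul_mem_interior (by norm_num) hc
  obtain ⟨c₂, hc₂, hc₂T⟩ := hequi _ hhalf a ha
  obtain ⟨N₁, hN₁⟩ := hua c₂ hc₂
  obtain ⟨N₂, hN₂⟩ := hTu _ hhalf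
  refine ⟨max N₁ N₂, fun n hn => ?_⟩
  have h₁ := hc₂T (u n) (hu n) (by rw [hd.symm]; exact hN₁ n (le_of_max_le_left hn)) n
  have h₂ := hN₂ n (le_of_max_le_right hn)
  have h := hP.add_mem_interior (hP.add_mem_interior h₁ (interior_subset h₂))
    (hd.triangle (T n a) (T n (u n)) (Tinf a))
  convert h using 1
  module
end
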